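/- Let H ∈ (0, 1/2). Then lim_{T→∞} M(T)/(2T) = σ², where σ² = H²Γ(2H)²σ_H², σ_H² = (4H−1)(1−1/cos(2Hπ)) for H ≠ 1/4 and σ_{1/4}² = 2/π. -/

import Mathlib

open Real MeasureTheory intervalIntegral

noncomputable def I1 (H T : ℝ) : ℝ :=
  ∫ t₁ in (0:ℝ)..T, ∫ t₂ in (0:ℝ)..T, ∫ s₁ in (0:ℝ)..T, ∫ s₂ in (0:ℝ)..T,
    Real.exp (-|t₁ - s₁| - |t₂ - s₂|) * Real.sign (s₁ - t₁) * Real.sign (t₂ - s₂) *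
      (Real.sign (t₂ - t₁) * |t₂ - t₁| ^ (2 * H - 1)) *
      (Real.sign (s₁ - s₂) * |s₁ - s₂| ^ (2 * H - 1))

noncomputable def I2 (H T : ℝ) : ℝ :=
  2 * ∫ t₁ in (0:ℝ)..T, ∫ t₂ in (0:ℝ)..T, ∫ s₁ in (0:ℝ)..T,
    Real.exp (-|t₁ - s₁| - t₂) * Real.sign (s₁ - t₁) *
      (Real.sign (t₂ - t₁) * |t₂ - t₁| ^ (2 * H - 1)) * s₁ ^ (2 * H - 1)

noncomputable def I3 (H T : ℝ) : ℝ :=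
  2 * (∫ u in (0:ℝ)..T, Real.exp (-u) * u ^ (2 * H - 1)) ^ 2 +
    2 * (Real.exp (-T) * ∫ u in (0:ℝ)..T, Real.exp u * u ^ (2 * H - 1)) ^ 2

/-- `fBmNormSqM H T` is the squared norm `‖f_T‖²` for `H ∈ (0,1/2)`. -/
noncomputable def fBmNormSqM (H T : ℝ) : ℝ := H ^ 2 * (I1 H T + 2 * I2 H T + I3 H T)

/-- `σ_H²`, with the value at `H = 1/4` interpreted as the limit `2/π`. -/
noncomputable def sigmaH2 (H : ℝ) : ℝ :=
  if H = 1/4 then 2 / π else (4 * H - 1) * (1 - 1 / Real.cos (2 * H * π))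

open Set Filter Topology
open scoped FourierTransform

lemma measurable_real_sign : Measurable Real.sign := by
  unfold Real.sign
  exact Measurable.ite measurableSet_Iio measurable_const
    (Measurable.ite measurableSet_Ioi measurable_const measurable_const)

lemma abs_real_sign_le (x : ℝ) : |Real.sign x| ≤ 1 := by
  rcases Real.sign_apply_eq x with h | h | h <;> simp [h]

/-- The odd function `sgn(x) e^{-|x|}`. -/
noncomputable def signExp (x : ℝ) : ℝ := Real.sign x * Real.exp (-|x|)

/-- The odd function `sgn(x) |x|^β`. -/
noncomputable def signPow (β x : ℝ) : ℝ := Real.sign x * |x| ^ β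

@[fun_prop]
lemma measurable_signExp : Measurable signExp :=
  measurable_real_sign.mul (by fun_prop)

@[fun_prop]
lemma measurable_signPow (β : ℝ) : Measurable (signPow β) :=
  measurable_real_sign.mul (by fun_prop)

lemma abs_signExp_le (x : ℝ) : |signExp x| ≤ Real.exp (-|x|) := by
  rw [signExp, abs_mul, abs_of_pos (Real.exp_pos _)]
  exact mul_le_of_le_one_left (Real.exp_pos _).le (abs_real_sign_le x)

lemma abs_signPow_le (β x : ℝ) : |signPow β x| ≤ |x| ^ β := by
  have h : 0 ≤ |x| ^ β := Real.rpow_nonneg (abs_nonneg x) β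
  rw [signPow, abs_mul, abs_of_nonneg h]
  exact mul_le_of_le_one_left h (abs_real_sign_le x)

lemma integrable_exp_neg_mul_abs {c : ℝ} (hc : 0 < c) :
    Integrable fun x : ℝ => Real.exp (-(c * |x|)) := by
  rw [← integrableOn_univ, ← Iic_union_Ioi (a := (0 : ℝ))]
  refine IntegrableOn.union ?_ ?_
  · refine (integrableOn_exp_mul_Iic hc 0).congr_fun (fun x hx => ?_) measurableSet_Iic
    simp [abs_of_nonpos (show x ≤ 0 from hx)]
  · refine (integrableOn_exp_mul_Ioi (neg_lt_zero.2 hc) 0).congr_fun (fun x hx => ?_)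
      measurableSet_Ioi
    simp [abs_of_pos (show 0 < x from hx)]

lemma integral_exp_neg_mul_abs {c : ℝ} (hc : 0 < c) :
    ∫ x : ℝ, Real.exp (-(c * |x|)) = 2 / c := by
  rw [integral_comp_abs (f := fun x => Real.exp (-(c * x)))]
  simp_rw [← neg_mul]
  rw [integral_exp_mul_Ioi (neg_lt_zero.2 hc)]
  simp; ring

lemma integrable_exp_neg_abs : Integrable fun x : ℝ => Real.exp (-|x|) := by
  simpa using integrable_exp_neg_mul_abs one_pos

lemma integral_exp_neg_abs : ∫ x : ℝ, Real.exp (-|x|) = 2 := by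
  simpa using integral_exp_neg_mul_abs one_pos

lemma locallyIntegrable_abs_rpow {β : ℝ} (hβ : -1 < β) (a b : ℝ) :
    IntegrableOn (fun x : ℝ => |x| ^ β) (Icc a b) := by
  have h : IntervalIntegrable (fun x : ℝ => |x| ^ β) volume (-(|a| + |b|)) (|a| + |b|) := by
    have h0 : ∀ c : ℝ, 0 ≤ c → IntervalIntegrable (fun x : ℝ => |x| ^ β) volume 0 c := by
      intro c hc
      refine (intervalIntegrable_rpow' hβ).congr (fun x hx => ?_)
      rw [uIoc_of_le hc] at hx
      simp [abs_of_pos hx.1]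
    have h1 := h0 (|a| + |b|) (by positivity)
    have h2 := h1.comp_mul_left (c := -1)
    rw [zero_div, div_neg, div_one] at h2
    simp only [neg_mul, one_mul, abs_neg] at h2
    exact h2.symm.trans h1
  have h3 := (intervalIntegrable_iff_integrableOn_Icc_of_le
    (by have := abs_nonneg a; have := abs_nonneg b; linarith)).1 h
  refine h3.mono_set (Icc_subset_Icc ?_ ?_)
  · have := neg_abs_le a; have := abs_nonneg b; linarith
  · have := le_abs_self b; have := abs_nonneg a; linarith

lemma integral_indicator_abs_rpow {β : ℝ} (hβ : -1 < β) :
    ∫ x : ℝ, (Icc (-1 : ℝ) 1).indicator (fun x => |x| ^ β) x = 2 / (β + 1) := by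
  have : (fun x : ℝ => (Icc (-1 : ℝ) 1).indicator (fun x => |x| ^ β) x) =
      fun x => (fun y : ℝ => (Iic (1 : ℝ)).indicator (fun y => y ^ β) y) |x| := by
    ext x
    simp only [indicator, mem_Icc, mem_Iic, abs_le]
  rw [this, integral_comp_abs (f := fun y : ℝ => (Iic (1 : ℝ)).indicator (fun y => y ^ β) y),
    setIntegral_indicator measurableSet_Iic, Ioi_inter_Iic,
    ← intervalIntegral.integral_of_le zero_le_one, integral_rpow (Or.inl hβ)]
  have : β + 1 ≠ 0 := by linarith
  simp [Real.zero_rpow this]; ring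

lemma exp_neg_abs_mul_abs_rpow_le {β : ℝ} (hβ0 : β < 0) (x y s : ℝ) :
    Real.exp (-|s - x|) * |s - y| ^ β ≤
      (Icc (-1 : ℝ) 1).indicator (fun x => |x| ^ β) (s - y) + Real.exp (-|s - x|) := by
  have h0 : 0 ≤ |s - y| ^ β := Real.rpow_nonneg (abs_nonneg _) β
  have he : 0 ≤ Real.exp (-|s - x|) := (Real.exp_pos _).le
  by_cases h : |s - y| ≤ 1
  · rw [indicator_of_mem (by exact abs_le.1 h)]
    have : Real.exp (-|s - x|) ≤ 1 := Real.exp_le_one_iff.2 (by simp)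
    nlinarith
  · have hm : s - y ∉ Icc (-1 : ℝ) 1 := fun h' => h (abs_le.2 h')
    rw [indicator_of_notMem hm, zero_add]
    exact mul_le_of_le_one_right he
      (Real.rpow_le_one_of_one_le_of_nonpos (not_le.1 h).le hβ0.le)

lemma integrable_exp_neg_abs_mul_abs_rpow_bound {β : ℝ} (hβ : -1 < β) (x y : ℝ) :
    Integrable fun s : ℝ => (Icc (-1 : ℝ) 1).indicator (fun x => |x| ^ β) (s - y) +
      Real.exp (-|s - x|) :=
  (((integrable_indicator_iff measurableSet_Icc).2
    (locallyIntegrable_abs_rpow hβ (-1) 1)).comp_sub_right y).add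
    (integrable_exp_neg_abs.comp_sub_right x)

lemma integrable_exp_neg_abs_mul_abs_rpow {β : ℝ} (hβ : -1 < β) (hβ0 : β < 0) (x y : ℝ) :
    Integrable fun s : ℝ => Real.exp (-|s - x|) * |s - y| ^ β := by
  refine (integrable_exp_neg_abs_mul_abs_rpow_bound hβ x y).mono'
    (Measurable.aestronglyMeasurable (by fun_prop)) (Eventually.of_forall fun s => ?_)
  rw [Real.norm_of_nonneg (mul_nonneg (Real.exp_pos _).le (Real.rpow_nonneg (abs_nonneg _) β))]
  exact exp_neg_abs_mul_abs_rpow_le hβ0 x y s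

lemma integral_exp_neg_abs_mul_abs_rpow_le {β : ℝ} (hβ : -1 < β) (hβ0 : β < 0) (x y : ℝ) :
    ∫ s : ℝ, Real.exp (-|s - x|) * |s - y| ^ β ≤ 2 / (β + 1) + 2 := by
  refine (integral_mono (integrable_exp_neg_abs_mul_abs_rpow hβ hβ0 x y)
    (integrable_exp_neg_abs_mul_abs_rpow_bound hβ x y)
    (exp_neg_abs_mul_abs_rpow_le hβ0 x y)).trans_eq ?_
  rw [MeasureTheory.integral_add (((integrable_indicator_iff measurableSet_Icc).2
    (locallyIntegrable_abs_rpow hβ (-1) 1)).comp_sub_right y)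
    (integrable_exp_neg_abs.comp_sub_right x),
    integral_sub_right_eq_self (fun s => (Icc (-1 : ℝ) 1).indicator (fun x => |x| ^ β) s) y,
    integral_sub_right_eq_self (fun s => Real.exp (-|s|)) x, integral_indicator_abs_rpow hβ,
    integral_exp_neg_abs]

lemma intervalIntegral_exp_neg_abs_mul_abs_rpow_le {β : ℝ} (hβ : -1 < β) (hβ0 : β < 0)
    {T : ℝ} (hT : 0 ≤ T) (x y : ℝ) :
    ∫ s in (0 : ℝ)..T, Real.exp (-|s - x|) * |s - y| ^ β ≤ 2 / (β + 1) + 2 := by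
  rw [intervalIntegral.integral_of_le hT]
  refine (setIntegral_le_integral (integrable_exp_neg_abs_mul_abs_rpow hβ hβ0 x y)
    (Eventually.of_forall fun s => ?_)).trans (integral_exp_neg_abs_mul_abs_rpow_le hβ hβ0 x y)
  exact mul_nonneg (Real.exp_pos _).le (Real.rpow_nonneg (abs_nonneg _) β)

lemma abs_signExp_mul_signPow_le (β x y s : ℝ) :
    |signExp (s - x) * signPow β (s - y)| ≤ Real.exp (-|s - x|) * |s - y| ^ β := by
  rw [abs_mul]
  exact mul_le_mul (abs_signExp_le _) (abs_signPow_le _ _) (abs_nonneg _) (Real.exp_pos _).le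

lemma integrable_signExp_mul_signPow {β : ℝ} (hβ : -1 < β) (hβ0 : β < 0) (x y : ℝ) :
    Integrable fun s : ℝ => signExp (s - x) * signPow β (s - y) :=
  (integrable_exp_neg_abs_mul_abs_rpow hβ hβ0 x y).mono'
    (Measurable.aestronglyMeasurable (by fun_prop))
    (Eventually.of_forall fun s => abs_signExp_mul_signPow_le β x y s)

/-- `∫ x^a (b+x²)^{-k} dx` over `(0,∞)`, as a Gamma product. -/
lemma integral_rpow_mul_add_sq_rpow {a k b : ℝ} (ha : -1 < a) (hk : 0 < k)
    (hak : (a + 1) / 2 < k) (hb : 0 < b) :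
    IntegrableOn (fun x : ℝ => x ^ a * (b + x ^ 2) ^ (-k)) (Ioi 0) ∧
    ∫ x in Ioi (0 : ℝ), x ^ a * (b + x ^ 2) ^ (-k) =
      Real.Gamma ((a + 1) / 2) * Real.Gamma (k - (a + 1) / 2) / (2 * Real.Gamma k) *
        b ^ ((a + 1) / 2 - k) := by
  set F : ℝ → ℝ → ℝ := fun x t => x ^ a * (t ^ (k - 1) * Real.exp (-((b + x ^ 2) * t))) with hF
  have hFx : ∀ t ∈ Ioi (0 : ℝ), ∫ x in Ioi (0 : ℝ), F x t =
      (1 / 2 * Real.Gamma ((a + 1) / 2)) *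
        (t ^ ((k - (a + 1) / 2) - 1) * Real.exp (-(b * t))) := by
    intro t ht
    have ht : 0 < t := ht
    have e : ∀ x : ℝ, F x t =
        (t ^ (k - 1) * Real.exp (-(b * t))) * (x ^ a * Real.exp (-t * x ^ (2 : ℝ))) := by
      intro x
      have : Real.exp (-((b + x ^ 2) * t)) = Real.exp (-(b * t)) * Real.exp (-t * x ^ (2 : ℝ)) := by
        rw [← Real.exp_add, Real.rpow_two]; congr 1; ring
      simp only [hF, this]; ring
    simp_rw [e]
    rw [MeasureTheory.integral_const_mul, integral_rpow_mul_exp_neg_mul_rpow two_pos ha ht]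
    have : t ^ (k - (a + 1) / 2 - 1) = t ^ (k - 1) * t ^ (-(a + 1) / 2) := by
      rw [← Real.rpow_add ht]; congr 1; ring
    rw [this]; ring
  have hmeas : AEStronglyMeasurable (Function.uncurry F)
      ((volume.restrict (Ioi (0 : ℝ))).prod (volume.restrict (Ioi (0 : ℝ)))) := by
    refine Measurable.aestronglyMeasurable ?_
    simp only [hF, Function.uncurry_def]
    fun_prop
  have hint : Integrable (Function.uncurry F)
      ((volume.restrict (Ioi (0 : ℝ))).prod (volume.restrict (Ioi (0 : ℝ)))) := by
    rw [integrable_prod_iff' hmeas]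
    constructor
    · filter_upwards [ae_restrict_mem measurableSet_Ioi] with t ht
      have ht : 0 < t := ht
      refine ((integrableOn_rpow_mul_exp_neg_mul_rpow (p := 2) ha two_pos ht).const_mul
        (t ^ (k - 1) * Real.exp (-(b * t)))).congr (Eventually.of_forall fun x => ?_)
      have : Real.exp (-((b + x ^ 2) * t)) = Real.exp (-(b * t)) * Real.exp (-t * x ^ (2 : ℝ)) := by
        rw [← Real.exp_add, Real.rpow_two]; congr 1; ring
      simp only [hF, this, Function.uncurry]; ring
    · have : Integrable (fun t : ℝ => (1 / 2 * Real.Gamma ((a + 1) / 2)) *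
          (t ^ ((k - (a + 1) / 2) - 1) * Real.exp (-(b * t)))) (volume.restrict (Ioi (0 : ℝ))) := by
        refine Integrable.const_mul ?_ _
        refine (integrableOn_rpow_mul_exp_neg_mul_rpow (p := 1)
          (s := k - (a + 1) / 2 - 1) (by linarith) one_pos hb).congr
          (Eventually.of_forall fun x => ?_)
        simp
      refine this.congr ?_
      filter_upwards [ae_restrict_mem measurableSet_Ioi] with t ht
      rw [← hFx t ht]
      refine setIntegral_congr_fun measurableSet_Ioi (fun x hx => ?_)
      have hx : 0 < x := hx
      have ht : 0 < t := ht
      simp only [Function.uncurry]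
      rw [Real.norm_of_nonneg]
      simp only [hF]; positivity
  have hFt : ∀ x ∈ Ioi (0 : ℝ), ∫ t in Ioi (0 : ℝ), F x t =
      Real.Gamma k * (x ^ a * (b + x ^ 2) ^ (-k)) := by
    intro x hx
    have hbx : 0 < b + x ^ 2 := by positivity
    simp only [hF]
    rw [MeasureTheory.integral_const_mul, integral_rpow_mul_exp_neg_mul_Ioi hk hbx, one_div,
      Real.inv_rpow hbx.le, Real.rpow_neg hbx.le]
    ring
  have hG : Real.Gamma k ≠ 0 := (Real.Gamma_pos_of_pos hk).ne'
  constructor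
  · have h1 := hint.integral_prod_left
    have h2 : IntegrableOn (fun x : ℝ => Real.Gamma k * (x ^ a * (b + x ^ 2) ^ (-k))) (Ioi 0) := by
      refine IntegrableOn.congr_fun h1 (fun x hx => ?_) measurableSet_Ioi
      exact hFt x hx
    have h3 := h2.const_mul (Real.Gamma k)⁻¹
    refine IntegrableOn.congr_fun h3 (fun x _ => ?_) measurableSet_Ioi
    field_simp
  · have h := integral_integral_swap hint
    rw [setIntegral_congr_fun measurableSet_Ioi hFt, setIntegral_congr_fun measurableSet_Ioi hFx,
      MeasureTheory.integral_const_mul, MeasureTheory.integral_const_mul,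
      integral_rpow_mul_exp_neg_mul_Ioi (by linarith) hb, one_div b, Real.inv_rpow hb.le,
      ← Real.rpow_neg hb.le, neg_sub] at h
    rw [mul_comm, ← eq_div_iff hG] at h
    rw [h]; ring

/-- The kernel obtained by correlating `signExp` with `signPow β` over the whole line. -/
noncomputable def signCorr (β r : ℝ) : ℝ := ∫ v : ℝ, signExp v * signPow β (v + r)

/-- The correlation of `signExp` with `sgn(x) e^{-l|x|}`, in closed form. -/
noncomputable def expCorr (l r : ℝ) : ℝ :=
  2 * (Real.exp (-|r|) - l * Real.exp (-(l * |r|))) / (1 - l ^ 2)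

lemma integral_signExp_mul_signPow (β x y : ℝ) :
    ∫ s : ℝ, signExp (s - x) * signPow β (s - y) = signCorr β (x - y) := by
  rw [signCorr, ← integral_sub_right_eq_self (fun v => signExp v * signPow β (v + (x - y))) x]
  simp

lemma abs_signCorr_le {β : ℝ} (hβ : -1 < β) (hβ0 : β < 0) (r : ℝ) :
    |signCorr β r| ≤ 2 / (β + 1) + 2 := by
  have h := integral_signExp_mul_signPow β 0 (-r)
  rw [zero_sub, neg_neg] at h
  rw [← h]
  exact (MeasureTheory.norm_integral_le_of_norm_le
    (f := fun s => signExp (s - 0) * signPow β (s - -r))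
    (integrable_exp_neg_abs_mul_abs_rpow hβ hβ0 0 (-r))
    (Eventually.of_forall fun s => abs_signExp_mul_signPow_le β 0 (-r) s)).trans
    (integral_exp_neg_abs_mul_abs_rpow_le hβ hβ0 0 (-r))

lemma continuousAt_signExp {x : ℝ} (hx : x ≠ 0) : ContinuousAt signExp x := by
  have h : ContinuousAt Real.sign x := by
    rcases hx.lt_or_gt with h | h
    · exact (continuousAt_const (y := (-1 : ℝ))).congr
        (by filter_upwards [Iio_mem_nhds h] with y hy using (Real.sign_of_neg hy).symm)
    · exact (continuousAt_const (y := (1 : ℝ))).congr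
        (by filter_upwards [Ioi_mem_nhds h] with y hy using (Real.sign_of_pos hy).symm)
  exact h.mul (by fun_prop)

lemma continuous_signCorr {β : ℝ} (hβ : -1 < β) (hβ0 : β < 0) : Continuous (signCorr β) := by
  have e : signCorr β = fun r => ∫ w : ℝ, signExp (w - r) * signPow β w := by
    ext r
    simpa using (integral_signExp_mul_signPow β r 0).symm
  rw [e, continuous_iff_continuousAt]
  intro r₀
  refine continuousAt_of_dominated
    (bound := fun w => Real.exp 1 * (Real.exp (-|w - r₀|) * |w - 0| ^ β)) ?_ ?_ ?_ ?_
  · exact Eventually.of_forall fun r => Measurable.aestronglyMeasurable (by fun_prop)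
  · filter_upwards [Metric.ball_mem_nhds r₀ one_pos] with r hr
    refine Eventually.of_forall fun w => ?_
    have h1 := abs_signExp_mul_signPow_le β r 0 w
    rw [sub_zero] at h1 ⊢
    refine h1.trans ?_
    rw [← mul_assoc, ← Real.exp_add]
    refine mul_le_mul_of_nonneg_right (Real.exp_le_exp.2 ?_) (Real.rpow_nonneg (abs_nonneg _) _)
    rw [Metric.mem_ball, Real.dist_eq] at hr
    have := abs_sub_abs_le_abs_sub (w - r₀) (w - r)
    rw [show w - r₀ - (w - r) = r - r₀ by ring] at this
    linarith
  · exact (integrable_exp_neg_abs_mul_abs_rpow hβ hβ0 r₀ 0).const_mul _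
  · have : ∀ᵐ w : ℝ, w ≠ r₀ := by simp [ae_iff, measure_singleton]
    filter_upwards [this] with w hw
    refine ContinuousAt.mul ?_ continuousAt_const
    exact ContinuousAt.comp (f := fun r => w - r) (continuousAt_signExp (sub_ne_zero.2 hw))
      (by fun_prop)

lemma integral_rpow_mul_exp_neg_Ioi {β : ℝ} (hβ0 : β < 0) {x : ℝ} (hx : x ≠ 0) :
    IntegrableOn (fun l : ℝ => l ^ (-(β + 1)) * Real.exp (-(l * |x|))) (Ioi 0) ∧
    ∫ l in Ioi (0 : ℝ), l ^ (-(β + 1)) * Real.exp (-(l * |x|)) = Real.Gamma (-β) * |x| ^ β := by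
  have hx' : 0 < |x| := abs_pos.2 hx
  constructor
  · refine (integrableOn_rpow_mul_exp_neg_mul_rpow (p := 1) (s := -(β + 1)) (by linarith)
      one_pos hx').congr (Eventually.of_forall fun l => ?_)
    simp [mul_comm]
  · have h := Real.integral_rpow_mul_exp_neg_mul_Ioi (a := -β) (by linarith) hx'
    simp_rw [mul_comm |x|] at h
    rw [show -(β + 1) = -β - 1 by ring, h, one_div, Real.inv_rpow hx'.le, Real.rpow_neg hx'.le,
      inv_inv, mul_comm]

lemma signExp_of_pos {x : ℝ} (hx : 0 < x) : signExp x = Real.exp (-x) := by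
  simp [signExp, Real.sign_of_pos hx, abs_of_pos hx]

lemma signExp_of_neg {x : ℝ} (hx : x < 0) : signExp x = -Real.exp x := by
  simp [signExp, Real.sign_of_neg hx, abs_of_neg hx]

lemma integrable_signExp_mul_sign_mul_exp {l : ℝ} (hl : 0 < l) (r : ℝ) :
    Integrable fun v : ℝ => signExp v * (Real.sign (v + r) * Real.exp (-(l * |v + r|))) := by
  refine integrable_exp_neg_abs.mono' (Measurable.aestronglyMeasurable ?_)
    (Eventually.of_forall fun v => ?_)
  · exact measurable_signExp.mul ((measurable_real_sign.comp (by fun_prop)).mul (by fun_prop))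
  · rw [norm_mul, norm_mul, Real.norm_eq_abs, Real.norm_eq_abs, Real.norm_eq_abs,
      abs_of_pos (Real.exp_pos _)]
    have h1 : Real.exp (-(l * |v + r|)) ≤ 1 := Real.exp_le_one_iff.2 (by
      have := mul_nonneg hl.le (abs_nonneg (v + r)); linarith)
    have h2 := mul_le_one₀ (abs_real_sign_le (v + r)) (Real.exp_pos _).le h1
    exact (mul_le_of_le_one_right (abs_nonneg _) h2).trans (abs_signExp_le v)

lemma integral_signExp_mul_sign_mul_exp {l : ℝ} (hl : 0 < l) (hl1 : l ≠ 1) (r : ℝ) :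
    ∫ v : ℝ, signExp v * (Real.sign (v + r) * Real.exp (-(l * |v + r|))) = expCorr l r := by
  wlog hr : 0 ≤ r generalizing r
  · have h := this (-r) (by linarith)
    rw [show expCorr l r = expCorr l (-r) by simp [expCorr], ← h, ← integral_neg_eq_self]
    congr 1
    ext v
    have h1 : signExp (-v) = -signExp v := by simp [signExp, Real.sign_neg]
    rw [show -v + r = -(v + -r) by ring, h1, Real.sign_neg, abs_neg]
    ring
  set f : ℝ → ℝ := fun v => signExp v * (Real.sign (v + r) * Real.exp (-(l * |v + r|)))
  have hf : Integrable f := integrable_signExp_mul_sign_mul_exp hl r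
  have hd : (1 : ℝ) - l ≠ 0 := sub_ne_zero.2 hl1.symm
  have hp : (1 : ℝ) + l ≠ 0 := by positivity
  have h1 : ∫ v in Iic (-r), f v = Real.exp (-r) / (1 + l) := by
    have : ∀ v ∈ Iio (-r), f v = Real.exp (l * r) * Real.exp ((1 + l) * v) := by
      intro v hv
      have hv : v < -r := hv
      have hv' : v + r < 0 := by linarith
      simp only [f]
      rw [signExp_of_neg (by linarith), Real.sign_of_neg hv', abs_of_neg hv', ← Real.exp_add]
      rw [neg_mul_comm, neg_mul, one_mul, neg_neg, ← Real.exp_add]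
      congr 1; ring
    rw [integral_Iic_eq_integral_Iio, setIntegral_congr_fun measurableSet_Iio this,
      ← integral_Iic_eq_integral_Iio, MeasureTheory.integral_const_mul,
      integral_exp_mul_Iic (by positivity), ← mul_div_assoc, ← Real.exp_add]
    congr 2; ring
  have h2 : ∫ v in (-r)..0, f v =
      -Real.exp (-(l * r)) * ((1 - Real.exp (-((1 - l) * r))) / (1 - l)) := by
    have : ∀ v ∈ Ioo (-r) 0, f v = -Real.exp (-(l * r)) * Real.exp ((1 - l) * v) := by
      intro v hv
      have hv' : 0 < v + r := by linarith [hv.1]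
      simp only [f]
      rw [signExp_of_neg hv.2, Real.sign_of_pos hv', abs_of_pos hv', one_mul, neg_mul, neg_mul,
        ← Real.exp_add, ← Real.exp_add]
      congr 2; ring
    rw [intervalIntegral.integral_of_le (by linarith), integral_Ioc_eq_integral_Ioo,
      setIntegral_congr_fun measurableSet_Ioo this, ← integral_Ioc_eq_integral_Ioo,
      ← intervalIntegral.integral_of_le (by linarith), intervalIntegral.integral_const_mul,
      intervalIntegral.integral_comp_mul_left _ hd, integral_exp]
    simp; ring
  have h3 : ∫ v in Ioi 0, f v = Real.exp (-(l * r)) / (1 + l) := by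
    have : ∀ v ∈ Ioi (0 : ℝ), f v = Real.exp (-(l * r)) * Real.exp (-(1 + l) * v) := by
      intro v hv
      have hv : 0 < v := hv
      have hv' : 0 < v + r := by linarith
      simp only [f]
      rw [signExp_of_pos hv, Real.sign_of_pos hv', abs_of_pos hv', one_mul,
        ← Real.exp_add, ← Real.exp_add]
      congr 1; ring
    rw [setIntegral_congr_fun measurableSet_Ioi this, MeasureTheory.integral_const_mul,
      integral_exp_mul_Ioi (by linarith)]
    rw [mul_zero, Real.exp_zero, neg_div_neg_eq]; ring
  rw [← integral_Iic_add_Ioi (b := -r) hf.integrableOn hf.integrableOn,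
    ← integral_interval_add_Ioi (b := 0) hf.integrableOn hf.integrableOn, h1, h2, h3, expCorr,
    abs_of_nonneg hr]
  have e : Real.exp (-((1 - l) * r)) * Real.exp (-(l * r)) = Real.exp (-r) := by
    rw [← Real.exp_add]; congr 1; ring
  have h4 : -Real.exp (-(l * r)) * ((1 - Real.exp (-((1 - l) * r))) / (1 - l)) =
      (Real.exp (-r) - Real.exp (-(l * r))) / (1 - l) := by rw [← e]; ring
  rw [h4, show 1 - l ^ 2 = (1 - l) * (1 + l) by ring]
  field_simp
  ring

lemma signCorr_eq_integral_expCorr {β : ℝ} (hβ : -1 < β) (hβ0 : β < 0) (r : ℝ) :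
    Real.Gamma (-β) * signCorr β r =
      ∫ l in Ioi (0 : ℝ), l ^ (-(β + 1)) * expCorr l r := by
  set F : ℝ → ℝ → ℝ := fun v l =>
    signExp v * (l ^ (-(β + 1)) * (Real.sign (v + r) * Real.exp (-(l * |v + r|))))
  have hF : ∀ v, v + r ≠ 0 →
      IntegrableOn (F v) (Ioi 0) ∧
      ∫ l in Ioi (0 : ℝ), F v l = Real.Gamma (-β) * (signExp v * signPow β (v + r)) := by
    intro v hv
    obtain ⟨h1, h2⟩ := integral_rpow_mul_exp_neg_Ioi (β := β) hβ0 hv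
    have e : F v = fun l => (signExp v * Real.sign (v + r)) *
        (l ^ (-(β + 1)) * Real.exp (-(l * |v + r|))) := by
      ext l; simp only [F]; ring
    rw [e]
    refine ⟨h1.const_mul _, ?_⟩
    rw [MeasureTheory.integral_const_mul, h2, signPow]; ring
  have hne : ∀ᵐ v : ℝ, v + r ≠ 0 := by
    have : ∀ᵐ v : ℝ, v ≠ -r := by simp [ae_iff, measure_singleton]
    filter_upwards [this] with v hv h
    exact hv (by linarith)
  have hmeas : AEStronglyMeasurable (Function.uncurry F)
      (volume.prod (volume.restrict (Ioi (0 : ℝ)))) := by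
    refine Measurable.aestronglyMeasurable ?_
    exact (measurable_signExp.comp measurable_fst).mul
      ((by fun_prop : Measurable fun p : ℝ × ℝ => p.2 ^ (-(β + 1))).mul
        ((measurable_real_sign.comp (by fun_prop : Measurable fun p : ℝ × ℝ => p.1 + r)).mul
          (by fun_prop)))
  have hint : Integrable (Function.uncurry F) (volume.prod (volume.restrict (Ioi (0 : ℝ)))) := by
    rw [integrable_prod_iff hmeas]
    refine ⟨hne.mono fun v hv => (hF v hv).1, ?_⟩
    have h0 := (integrable_signExp_mul_signPow hβ hβ0 0 (-r)).norm.const_mul (Real.Gamma (-β))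
    refine h0.congr (hne.mono fun v hv => ?_)
    simp only [Function.uncurry, F, sub_zero, sub_neg_eq_add, norm_mul]
    obtain ⟨-, h2⟩ := integral_rpow_mul_exp_neg_Ioi (β := β) hβ0 hv
    rw [MeasureTheory.integral_const_mul]
    have : ∀ l ∈ Ioi (0 : ℝ), ‖l ^ (-(β + 1))‖ *
        (‖Real.sign (v + r)‖ * ‖Real.exp (-(l * |v + r|))‖) =
        ‖Real.sign (v + r)‖ * (l ^ (-(β + 1)) * Real.exp (-(l * |v + r|))) := by
      intro l hl
      rw [Real.norm_of_nonneg (Real.rpow_nonneg (le_of_lt hl) _),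
        Real.norm_of_nonneg (Real.exp_pos _).le]
      ring
    rw [setIntegral_congr_fun measurableSet_Ioi this, MeasureTheory.integral_const_mul, h2, signPow,
      norm_mul, Real.norm_of_nonneg (Real.rpow_nonneg (abs_nonneg (v + r)) β)]
    ring
  have h := integral_integral_swap hint
  rw [integral_congr_ae (hne.mono fun v hv => (hF v hv).2), MeasureTheory.integral_const_mul] at h
  rw [signCorr, h]
  refine integral_congr_ae ?_
  have hl1 : ∀ᵐ l : ℝ ∂(volume.restrict (Ioi 0)), l ≠ 1 :=
    ae_restrict_of_ae (by simp [ae_iff, measure_singleton])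
  filter_upwards [ae_restrict_mem measurableSet_Ioi, hl1] with l hl hl1
  rw [← integral_signExp_mul_sign_mul_exp hl hl1, ← MeasureTheory.integral_const_mul]
  congr 1; ext v; simp only [F]; ring

lemma integrable_comp_abs {f : ℝ → ℝ} (hf : IntegrableOn f (Ioi 0)) :
    Integrable fun x => f |x| := by
  have h1 : IntegrableOn (fun x => f |x|) (Ioi 0) :=
    hf.congr_fun (fun x hx => by rw [abs_of_pos (show 0 < x from hx)]) measurableSet_Ioi
  have h2 : IntegrableOn (fun x => f |x|) (Iio 0) := by
    have := IntegrableOn.comp_neg_Iio (c := (0 : ℝ)) (by simpa using h1)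
    simpa using this
  rw [← integrableOn_univ, ← Iic_union_Ioi (a := (0 : ℝ))]
  exact (Iff.mpr integrableOn_Iic_iff_integrableOn_Iio h2).union h1

lemma integrable_expCorr {l : ℝ} (hl : 0 < l) : Integrable (expCorr l) := by
  unfold expCorr
  exact (((integrable_exp_neg_abs.sub ((integrable_exp_neg_mul_abs hl).const_mul l)).const_mul
    2).div_const _)

lemma integral_abs_expCorr_le {l : ℝ} (hl : 0 < l) (hl1 : l ≠ 1) :
    ∫ r : ℝ, |expCorr l r| ≤ 8 * (1 + l)⁻¹ := by
  have hd : 0 < |1 - l| := abs_pos.2 (sub_ne_zero.2 hl1.symm)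
  have hi := integrable_exp_neg_mul_abs hl
  have hdiff : ∫ r : ℝ, |Real.exp (-|r|) - Real.exp (-(l * |r|))| = 2 * |1 - l| / l := by
    have key : ∫ r : ℝ, (Real.exp (-|r|) - Real.exp (-(l * |r|))) = 2 - 2 / l := by
      rw [MeasureTheory.integral_sub integrable_exp_neg_abs hi, integral_exp_neg_abs,
        integral_exp_neg_mul_abs hl]
    rcases hl1.lt_or_gt with h | h
    · have : ∀ r : ℝ, |Real.exp (-|r|) - Real.exp (-(l * |r|))| =
          -(Real.exp (-|r|) - Real.exp (-(l * |r|))) := fun r => by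
        refine abs_of_nonpos (sub_nonpos.2 (Real.exp_le_exp.2 ?_))
        nlinarith [abs_nonneg r]
      simp_rw [this]
      rw [MeasureTheory.integral_neg, key, abs_of_pos (by linarith)]
      field_simp; ring
    · have : ∀ r : ℝ, |Real.exp (-|r|) - Real.exp (-(l * |r|))| =
          Real.exp (-|r|) - Real.exp (-(l * |r|)) := fun r => by
        refine abs_of_nonneg (sub_nonneg.2 (Real.exp_le_exp.2 ?_))
        nlinarith [abs_nonneg r]
      simp_rw [this]
      rw [key, abs_of_neg (by linarith)]
      field_simp; ring
  have hle : ∀ r : ℝ, |expCorr l r| ≤ 2 / |1 - l ^ 2| * (|1 - l| * Real.exp (-|r|) +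
      l * |Real.exp (-|r|) - Real.exp (-(l * |r|))|) := by
    intro r
    rw [expCorr, abs_div, abs_mul, abs_two, div_mul_eq_mul_div]
    gcongr
    calc |Real.exp (-|r|) - l * Real.exp (-(l * |r|))|
        = |(1 - l) * Real.exp (-|r|) + l * (Real.exp (-|r|) - Real.exp (-(l * |r|)))| := by
          congr 1; ring
      _ ≤ _ := (abs_add_le _ _).trans_eq (by
          rw [abs_mul, abs_mul, abs_of_pos (Real.exp_pos _), abs_of_pos hl])
  have hi2 := (integrable_exp_neg_abs.sub hi).abs.const_mul l
  refine (integral_mono (integrable_expCorr hl).abs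
    (((integrable_exp_neg_abs.const_mul |1 - l|).add hi2).const_mul _) hle).trans_eq ?_
  simp only [Pi.add_apply, Pi.sub_apply]
  rw [MeasureTheory.integral_const_mul]
  erw [MeasureTheory.integral_add (integrable_exp_neg_abs.const_mul |1 - l|) hi2]
  simp only [Pi.sub_apply]
  rw [MeasureTheory.integral_const_mul, MeasureTheory.integral_const_mul, integral_exp_neg_abs,
    hdiff, show 1 - l ^ 2 = (1 - l) * (1 + l) by ring, abs_mul, abs_of_pos (by linarith : 0 < 1 + l)]
  field_simp; ring

lemma integrable_rpow_mul_expCorr {β : ℝ} (hβ : -1 < β) (hβ0 : β < 0) :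
    Integrable (fun p : ℝ × ℝ => p.1 ^ (-(β + 1)) * expCorr p.1 p.2)
      ((volume.restrict (Ioi (0 : ℝ))).prod volume) := by
  have hmeas : Measurable (fun p : ℝ × ℝ => p.1 ^ (-(β + 1)) * expCorr p.1 p.2) := by
    unfold expCorr; fun_prop
  rw [integrable_prod_iff hmeas.aestronglyMeasurable]
  have hl1 : ∀ᵐ l : ℝ ∂(volume.restrict (Ioi 0)), l ≠ 1 :=
    ae_restrict_of_ae (by simp [ae_iff, measure_singleton])
  constructor
  · filter_upwards [ae_restrict_mem measurableSet_Ioi] with l hl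
    exact (integrable_expCorr hl).const_mul _
  · have h := (integral_rpow_mul_add_sq_rpow (a := -(β + 1)) (k := 1 / 2) (b := 1)
      (by linarith) (by norm_num) (by linarith) one_pos).1.const_mul 8
    refine h.mono' hmeas.aestronglyMeasurable.norm.integral_prod_right' ?_
    filter_upwards [ae_restrict_mem measurableSet_Ioi, hl1] with l hl hl1
    have hl : 0 < l := hl
    rw [Real.norm_of_nonneg (integral_nonneg fun _ => norm_nonneg _)]
    simp only [norm_mul]
    rw [MeasureTheory.integral_const_mul, Real.norm_of_nonneg (Real.rpow_nonneg hl.le _),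
      mul_left_comm]
    refine mul_le_mul_of_nonneg_left ((integral_abs_expCorr_le hl hl1).trans ?_)
      (Real.rpow_nonneg hl.le _)
    rw [Real.rpow_neg (by positivity), ← Real.sqrt_eq_rpow]
    gcongr
    exact Real.sqrt_le_iff.2 ⟨by positivity, by nlinarith⟩

lemma integrable_signCorr {β : ℝ} (hβ : -1 < β) (hβ0 : β < 0) : Integrable (signCorr β) := by
  have hG : Real.Gamma (-β) ≠ 0 := (Real.Gamma_pos_of_pos (by linarith)).ne'
  refine ((integrable_rpow_mul_expCorr hβ hβ0).integral_prod_right.const_mul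
    (Real.Gamma (-β))⁻¹).congr (Eventually.of_forall fun r => ?_)
  simp only [← signCorr_eq_integral_expCorr hβ hβ0 r]
  field_simp

lemma integral_cexp_mul_exp_neg_mul_abs {c : ℝ} (hc : 0 < c) (w : ℝ) :
    ∫ x : ℝ, Complex.exp (↑(w * x) * Complex.I) * (Real.exp (-(c * |x|)) : ℂ) =
      ((2 * c / (c ^ 2 + w ^ 2) : ℝ) : ℂ) := by
  set f : ℝ → ℂ := fun x => Complex.exp (↑(w * x) * Complex.I) * (Real.exp (-(c * |x|)) : ℂ)
  have h1 : EqOn f (fun x : ℝ => Complex.exp ((c + w * Complex.I) * x)) (Iic 0) := by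
    intro x hx
    simp only [f, abs_of_nonpos (show x ≤ 0 from hx)]
    push_cast
    rw [← Complex.exp_add]; congr 1; ring
  have h2 : EqOn f (fun x : ℝ => Complex.exp ((-c + w * Complex.I) * x)) (Ioi 0) := by
    intro x hx
    simp only [f, abs_of_pos (show 0 < x from hx)]
    push_cast
    rw [← Complex.exp_add]; congr 1; ring
  have hr1 : 0 < ((c : ℂ) + w * Complex.I).re := by simpa using hc
  have hr2 : (-(c : ℂ) + w * Complex.I).re < 0 := by simpa using hc
  rw [← integral_Iic_add_Ioi (b := 0)
    ((integrableOn_exp_mul_complex_Iic hr1 0).congr_fun h1.symm measurableSet_Iic)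
    ((integrableOn_exp_mul_complex_Ioi hr2 0).congr_fun h2.symm measurableSet_Ioi),
    setIntegral_congr_fun measurableSet_Iic h1, setIntegral_congr_fun measurableSet_Ioi h2,
    integral_exp_mul_complex_Iic hr1, integral_exp_mul_complex_Ioi hr2]
  have n1 : (c : ℂ) + w * Complex.I ≠ 0 := fun h => by rw [h] at hr1; simp at hr1
  have n2 : -(c : ℂ) + w * Complex.I ≠ 0 := fun h => by rw [h] at hr2; simp at hr2
  have n3 : (c : ℂ) ^ 2 + w ^ 2 ≠ 0 := by
    have : (c ^ 2 + w ^ 2 : ℝ) ≠ 0 := by positivity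
    exact_mod_cast this
  simp only [Complex.ofReal_zero, mul_zero, Complex.exp_zero]
  push_cast
  field_simp
  ring_nf
  simp only [Complex.I_sq]
  ring

lemma integral_cexp_mul_expCorr {l : ℝ} (hl : 0 < l) (hl1 : l ≠ 1) (w : ℝ) :
    ∫ r : ℝ, Complex.exp (↑(w * r) * Complex.I) * (expCorr l r : ℂ) =
      ((4 * w ^ 2 / (1 + w ^ 2) * (w ^ 2 + l ^ 2)⁻¹ : ℝ) : ℂ) := by
  have hi : ∀ {c : ℝ}, 0 < c → Integrable fun x : ℝ =>
      Complex.exp (↑(w * x) * Complex.I) * (Real.exp (-(c * |x|)) : ℂ) := by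
    intro c hc
    refine (integrable_exp_neg_mul_abs hc).ofReal.bdd_mul (c := 1)
      (Continuous.aestronglyMeasurable (by fun_prop)) (Eventually.of_forall fun x => ?_)
    rw [Complex.norm_exp_ofReal_mul_I]
  have hd : (1 : ℝ) - l ^ 2 ≠ 0 := by
    rw [show 1 - l ^ 2 = (1 - l) * (1 + l) by ring]
    exact mul_ne_zero (sub_ne_zero.2 hl1.symm) (by positivity)
  have e : ∀ r : ℝ, Complex.exp (↑(w * r) * Complex.I) * (expCorr l r : ℂ) =
      ((2 / (1 - l ^ 2) : ℝ) : ℂ) *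
        (Complex.exp (↑(w * r) * Complex.I) * (Real.exp (-(1 * |r|)) : ℂ) -
        (l : ℂ) * (Complex.exp (↑(w * r) * Complex.I) * (Real.exp (-(l * |r|)) : ℂ))) := by
    intro r
    rw [expCorr, one_mul]; push_cast; ring
  simp_rw [e]
  rw [MeasureTheory.integral_const_mul, MeasureTheory.integral_sub (hi one_pos)
    ((hi hl).const_mul _), MeasureTheory.integral_const_mul,
    integral_cexp_mul_exp_neg_mul_abs one_pos, integral_cexp_mul_exp_neg_mul_abs hl]
  norm_cast
  have : w ^ 2 + l ^ 2 ≠ 0 := by positivity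
  have : l ^ 2 + w ^ 2 ≠ 0 := by positivity
  have : 1 + w ^ 2 ≠ 0 := by positivity
  field_simp
  ring

/-- The constant in the Fourier transform of `signCorr β`. -/
noncomputable def signCorrConst (β : ℝ) : ℝ :=
  2 * (Real.Gamma (-β / 2) * Real.Gamma (1 + β / 2)) / Real.Gamma (-β)

lemma integral_cexp_mul_signCorr {β : ℝ} (hβ : -1 < β) (hβ0 : β < 0) (w : ℝ) :
    ∫ r : ℝ, Complex.exp (↑(w * r) * Complex.I) * (signCorr β r : ℂ) =
      ((signCorrConst β * (|w| ^ (-β) / (1 + w ^ 2)) : ℝ) : ℂ) := by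
  have hG : Real.Gamma (-β) ≠ 0 := (Real.Gamma_pos_of_pos (by linarith)).ne'
  set F : ℝ → ℝ → ℂ := fun l r =>
    Complex.exp (↑(w * r) * Complex.I) * ((l ^ (-(β + 1)) * expCorr l r : ℝ) : ℂ)
  have hint : Integrable (Function.uncurry F) ((volume.restrict (Ioi (0 : ℝ))).prod volume) := by
    have hc : Continuous fun p : ℝ × ℝ => Complex.exp (↑(w * p.2) * Complex.I) := by fun_prop
    exact (integrable_rpow_mul_expCorr hβ hβ0).ofReal.bdd_mul (c := 1)
      hc.aestronglyMeasurable (Eventually.of_forall fun x => by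
        rw [Complex.norm_exp_ofReal_mul_I])
  have h := integral_integral_swap hint
  have h1 : ∀ r : ℝ, ∫ l in Ioi (0 : ℝ), F l r =
      (Real.Gamma (-β) : ℂ) * (Complex.exp (↑(w * r) * Complex.I) * (signCorr β r : ℂ)) := by
    intro r
    simp only [F]
    rw [MeasureTheory.integral_const_mul, integral_complex_ofReal,
      ← signCorr_eq_integral_expCorr hβ hβ0 r]
    push_cast; ring
  have hl1 : ∀ᵐ l : ℝ ∂(volume.restrict (Ioi 0)), l ≠ 1 :=
    ae_restrict_of_ae (by simp [ae_iff, measure_singleton])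
  have h2 : ∫ l in Ioi (0 : ℝ), ∫ r : ℝ, F l r = ∫ l in Ioi (0 : ℝ),
      ((4 * w ^ 2 / (1 + w ^ 2) * (l ^ (-(β + 1)) * (w ^ 2 + l ^ 2) ^ (-1 : ℝ)) : ℝ) : ℂ) := by
    refine integral_congr_ae ?_
    filter_upwards [ae_restrict_mem measurableSet_Ioi, hl1] with l hl hl1
    have e : ∀ r, F l r = ((l ^ (-(β + 1)) : ℝ) : ℂ) *
        (Complex.exp (↑(w * r) * Complex.I) * (expCorr l r : ℂ)) := by
      intro r; simp only [F]; push_cast; ring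
    simp_rw [e]
    rw [MeasureTheory.integral_const_mul, integral_cexp_mul_expCorr hl hl1, ← Complex.ofReal_mul,
      Real.rpow_neg_one]
    congr 1; ring
  simp_rw [h1] at h
  rw [h2, MeasureTheory.integral_const_mul, integral_complex_ofReal,
    MeasureTheory.integral_const_mul] at h
  have hG' : (Real.Gamma (-β) : ℂ) ≠ 0 := by exact_mod_cast hG
  rw [← mul_right_inj' hG', ← h, ← Complex.ofReal_mul]
  congr 1
  rcases eq_or_ne w 0 with rfl | hw
  · simp [Real.zero_rpow (by linarith : -β ≠ 0)]
  have hw' : 0 < |w| := abs_pos.2 hw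
  rw [(integral_rpow_mul_add_sq_rpow (a := -(β + 1)) (k := 1) (b := w ^ 2)
      (by linarith) one_pos (by linarith) (by positivity)).2, signCorrConst, Real.Gamma_one,
      ← sq_abs w, ← Real.rpow_natCast |w| 2, ← Real.rpow_mul hw'.le]
  have e1 : |w| ^ (-β) = |w| ^ ((2 : ℕ) : ℝ) * |w| ^ (((2 : ℕ) : ℝ) * ((-(β + 1) + 1) / 2 - 1)) := by
    rw [← Real.rpow_add hw']; congr 1; push_cast; ring
  rw [e1, show (-(β + 1) + 1) / 2 = -β / 2 by ring, show 1 - -β / 2 = 1 + β / 2 by ring]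
  field_simp
  ring

lemma signCorr_neg {β : ℝ} (hβ : -1 < β) (hβ0 : β < 0) (r : ℝ) :
    signCorr β (-r) = signCorr β r := by
  have hG : Real.Gamma (-β) ≠ 0 := (Real.Gamma_pos_of_pos (by linarith)).ne'
  refine mul_left_cancel₀ hG ?_
  rw [signCorr_eq_integral_expCorr hβ hβ0, signCorr_eq_integral_expCorr hβ hβ0]
  simp [expCorr]

/-- Plancherel for `signCorr β`. -/
lemma integral_signCorr_sq {β : ℝ} (hβ : -1 < β) (hβ0 : β < 0) :
    ∫ r : ℝ, signCorr β r ^ 2 =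
      signCorrConst β ^ 2 / π * (Real.Gamma (1 / 2 - β) * Real.Gamma (3 / 2 + β) / 2) := by
  set Φ : ℝ → ℝ := fun w => signCorrConst β * (|w| ^ (-β) / (1 + w ^ 2))
  have hF : ∀ w : ℝ, 𝓕 (fun r : ℝ => (signCorr β r : ℂ)) w = (Φ (2 * π * w) : ℂ) := by
    intro w
    rw [Real.fourier_real_eq_integral_exp_smul]
    have h := integral_cexp_mul_signCorr hβ hβ0 (-2 * π * w)
    have e : Φ (2 * π * w) = Φ (-2 * π * w) := by simp [Φ, abs_mul]
    rw [e, ← h]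
    congr 1; ext r
    rw [smul_eq_mul, show -2 * π * r * w = -2 * π * w * r by ring]
  have hΦ : Integrable Φ := by
    refine Integrable.const_mul ?_ _
    have h := (integral_rpow_mul_add_sq_rpow (a := -β) (k := 1) (b := 1) (by linarith) one_pos
      (by linarith) one_pos).1
    have e : (fun w : ℝ => |w| ^ (-β) / (1 + w ^ 2)) =
        fun w : ℝ => (fun x : ℝ => x ^ (-β) * (1 + x ^ 2) ^ (-1 : ℝ)) |w| := by
      ext w
      simp only [Real.rpow_neg_one, sq_abs, div_eq_mul_inv]
    rw [e]
    exact integrable_comp_abs h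
  have hg : 𝓕 (fun r : ℝ => (signCorr β r : ℂ)) = fun w => (Φ (2 * π * w) : ℂ) := funext hF
  have hfi : Integrable (fun r : ℝ => (signCorr β r : ℂ)) := (integrable_signCorr hβ hβ0).ofReal
  have hgi : Integrable (𝓕 (fun r : ℝ => (signCorr β r : ℂ))) := by
    rw [hg]
    exact (hΦ.comp_mul_left' (by positivity)).ofReal
  have hgg : 𝓕 (𝓕 (fun r : ℝ => (signCorr β r : ℂ))) = fun r : ℝ => (signCorr β r : ℂ) := by
    ext x
    have h := congrFun (Continuous.fourierInv_fourier_eq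
      (Complex.continuous_ofReal.comp (continuous_signCorr hβ hβ0)) hfi hgi) (-x)
    rw [Real.fourierInv_eq_fourier_neg, neg_neg] at h
    exact h.trans (by simp [signCorr_neg hβ hβ0])
  have hP := VectorFourier.integral_fourierIntegral_smul_eq_flip (L := innerₗ ℝ)
    Real.continuous_fourierChar continuous_inner hfi hgi
  rw [flip_innerₗ] at hP
  change ∫ w : ℝ, 𝓕 (fun r : ℝ => (signCorr β r : ℂ)) w • 𝓕 (fun r : ℝ => (signCorr β r : ℂ)) w =
    ∫ x : ℝ, (signCorr β x : ℂ) • 𝓕 (𝓕 (fun r : ℝ => (signCorr β r : ℂ))) x at hP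
  rw [hgg, hg] at hP
  simp only [smul_eq_mul, ← Complex.ofReal_mul] at hP
  rw [integral_complex_ofReal, integral_complex_ofReal, Complex.ofReal_inj] at hP
  simp_rw [pow_two (signCorr β _)]
  rw [← hP, Measure.integral_comp_mul_left (fun w => Φ w * Φ w) (2 * π)]
  have e : ∀ w : ℝ, Φ w * Φ w = signCorrConst β ^ 2 *
      (fun x : ℝ => x ^ (-2 * β) * (1 + x ^ 2) ^ (-2 : ℝ)) |w| := by
    intro w
    have h1 : |w| ^ (-2 * β) = (|w| ^ (-β)) ^ 2 := by
      rw [← Real.rpow_natCast, ← Real.rpow_mul (abs_nonneg w)]; congr 1; push_cast; ring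
    have h2 : (1 + w ^ 2) ^ (-2 : ℝ) = ((1 + w ^ 2) ^ 2)⁻¹ := by
      rw [Real.rpow_neg (by positivity), Real.rpow_two]
    simp only [Φ, sq_abs, h1, h2]
    generalize |w| ^ (-β) = y
    field_simp
  simp_rw [e]
  rw [MeasureTheory.integral_const_mul, integral_comp_abs
    (f := fun x : ℝ => x ^ (-2 * β) * (1 + x ^ 2) ^ (-2 : ℝ)),
    (integral_rpow_mul_add_sq_rpow (a := -2 * β) (k := 2) (b := 1) (by linarith) two_pos
      (by linarith) one_pos).2, Real.Gamma_two, Real.one_rpow,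
    show (-2 * β + 1) / 2 = 1 / 2 - β by ring, show 2 - (1 / 2 - β) = 3 / 2 + β by ring,
    abs_of_pos (by positivity), smul_eq_mul]
  field_simp

lemma signCorrConst_eq {H : ℝ} (hH : 0 < H) (hH2 : H < 1 / 2) :
    signCorrConst (2 * H - 1) = 4 * Real.Gamma (2 * H) * Real.sin (π * H) := by
  have hc : 0 < Real.cos (π * H) :=
    Real.cos_pos_of_mem_Ioo ⟨by nlinarith [pi_pos], by nlinarith [pi_pos]⟩
  have hs : 0 < Real.sin (π * H) := Real.sin_pos_of_pos_of_lt_pi (by positivity)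
    (by nlinarith [pi_pos])
  have h1 := Real.Gamma_mul_Gamma_one_sub (1 / 2 + H)
  have h2 := Real.Gamma_mul_Gamma_one_sub (2 * H)
  have hG : Real.Gamma (1 - 2 * H) ≠ 0 := (Real.Gamma_pos_of_pos (by linarith)).ne'
  rw [show π * (1 / 2 + H) = π * H + π / 2 by ring, Real.sin_add_pi_div_two,
    show 1 - (1 / 2 + H) = 1 / 2 - H by ring] at h1
  rw [show π * (2 * H) = 2 * (π * H) by ring, Real.sin_two_mul] at h2
  rw [signCorrConst, show -(2 * H - 1) / 2 = 1 / 2 - H by ring,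
    show 1 + (2 * H - 1) / 2 = 1 / 2 + H by ring, show -(2 * H - 1) = 1 - 2 * H by ring,
    mul_comm (Real.Gamma (1 / 2 - H)), h1, div_eq_iff hG]
  have h3 : Real.Gamma (2 * H) * Real.Gamma (1 - 2 * H) * (2 * Real.sin (π * H) *
      Real.cos (π * H)) = π := by rw [h2]; field_simp
  field_simp
  linear_combination (-2) * h3

lemma integral_signCorr_sq_eq {H : ℝ} (hH : 0 < H) (hH2 : H < 1 / 2) :
    ∫ r : ℝ, signCorr (2 * H - 1) r ^ 2 = 2 * (Real.Gamma (2 * H) ^ 2 * sigmaH2 H) := by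
  rw [integral_signCorr_sq (by linarith) (by linarith), signCorrConst_eq hH hH2, sigmaH2]
  split_ifs with h
  · subst h
    norm_num [Real.Gamma_one]
    rw [show π * (1 / 4) = π / 4 by ring, Real.sin_pi_div_four]
    have := Real.sq_sqrt (show (0 : ℝ) ≤ 2 by norm_num)
    field_simp
    rw [this]; norm_num
  · have hne : 1 / 2 - 2 * H ≠ 0 := fun h' => h (by linarith)
    have h1 := Real.Gamma_mul_Gamma_one_sub (1 / 2 + 2 * H)
    rw [show π * (1 / 2 + 2 * H) = 2 * (π * H) + π / 2 by ring, Real.sin_add_pi_div_two,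
      show 1 - (1 / 2 + 2 * H) = 1 / 2 - 2 * H by ring] at h1
    have hcos : Real.cos (2 * (π * H)) ≠ 0 := by
      intro h0
      rcases lt_or_gt_of_ne h with h' | h'
      · exact (Real.cos_pos_of_mem_Ioo ⟨by nlinarith [pi_pos], by nlinarith [pi_pos]⟩).ne' h0
      · exact (Real.cos_neg_of_pi_div_two_lt_of_lt (by nlinarith [pi_pos])
          (by nlinarith [pi_pos])).ne h0
    rw [show 1 / 2 - (2 * H - 1) = (1 / 2 - 2 * H) + 1 by ring, Real.Gamma_add_one hne,
      show 3 / 2 + (2 * H - 1) = 1 / 2 + 2 * H by ring, mul_assoc (1 / 2 - 2 * H),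
      mul_comm (Real.Gamma (1 / 2 - 2 * H)), h1, show 2 * H * π = 2 * (π * H) by ring]
    have hs : Real.sin (π * H) ^ 2 = (1 - Real.cos (2 * (π * H))) / 2 := by
      rw [Real.cos_two_mul, Real.cos_sq']; ring
    rw [mul_pow, hs]
    generalize Real.cos (2 * (π * H)) = c at hcos ⊢
    field_simp
    ring

lemma integrable_prod_of_integral_abs_le {μ ν : Measure ℝ} [SFinite μ] [IsFiniteMeasure ν] {C : ℝ}
    {F : ℝ × ℝ → ℝ} (hF : Measurable F) (hi : ∀ y, Integrable (fun x => F (x, y)) μ)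
    (hb : ∀ y, ∫ x, |F (x, y)| ∂μ ≤ C) : Integrable F (μ.prod ν) := by
  rw [integrable_prod_iff' hF.aestronglyMeasurable]
  refine ⟨Eventually.of_forall hi, ?_⟩
  refine (integrable_const C).mono' ?_ (Eventually.of_forall fun y => ?_)
  · exact (hF.norm.comp measurable_swap).stronglyMeasurable.integral_prod_right'.aestronglyMeasurable
  · rw [Real.norm_of_nonneg (integral_nonneg fun x => norm_nonneg _)]
    exact hb y

lemma setIntegral_Ioo_exp_neg_abs_mul_abs_rpow_le {β : ℝ} (hβ : -1 < β) (hβ0 : β < 0)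
    (T x y : ℝ) :
    ∫ s in Ioo 0 T, Real.exp (-|s - x|) * |s - y| ^ β ≤ 2 / (β + 1) + 2 :=
  (setIntegral_le_integral (integrable_exp_neg_abs_mul_abs_rpow hβ hβ0 x y)
    (Eventually.of_forall fun _ => mul_nonneg (Real.exp_pos _).le
      (Real.rpow_nonneg (abs_nonneg _) β))).trans (integral_exp_neg_abs_mul_abs_rpow_le hβ hβ0 x y)

/-- The truncation to `(0, T)` of the integral defining `signCorr β (x - y)`. -/
noncomputable def truncCorr (β T x y : ℝ) : ℝ :=
  ∫ s in Ioo 0 T, signExp (s - x) * signPow β (s - y)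

lemma measurable_truncCorr (β T : ℝ) : Measurable fun p : ℝ × ℝ => truncCorr β T p.1 p.2 := by
  unfold truncCorr
  refine StronglyMeasurable.measurable (StronglyMeasurable.integral_prod_right
    (f := fun (p : ℝ × ℝ) s => signExp (s - p.1) * signPow β (s - p.2))
    (Measurable.stronglyMeasurable ?_))
  simp only [Function.uncurry_def]
  fun_prop

lemma setIntegral_abs_signExp_mul_signPow_le {β : ℝ} (hβ : -1 < β) (hβ0 : β < 0) (T x y : ℝ) :
    ∫ s in Ioo 0 T, |signExp (s - x) * signPow β (s - y)| ≤ 2 / (β + 1) + 2 :=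
  (integral_mono (integrable_signExp_mul_signPow hβ hβ0 x y).abs.integrableOn
    (integrable_exp_neg_abs_mul_abs_rpow hβ hβ0 x y).integrableOn
    (fun s => abs_signExp_mul_signPow_le β x y s)).trans
    (setIntegral_Ioo_exp_neg_abs_mul_abs_rpow_le hβ hβ0 T x y)

lemma abs_truncCorr_le {β : ℝ} (hβ : -1 < β) (hβ0 : β < 0) (T x y : ℝ) :
    |truncCorr β T x y| ≤ 2 / (β + 1) + 2 :=
  (MeasureTheory.abs_integral_le_integral_abs).trans
    (setIntegral_abs_signExp_mul_signPow_le hβ hβ0 T x y)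

lemma abs_signExp_le_one (x : ℝ) : |signExp x| ≤ 1 :=
  (abs_signExp_le x).trans (Real.exp_le_one_iff.2 (neg_nonpos.2 (abs_nonneg x)))

lemma setIntegral_eq_truncCorr_mul {β : ℝ} (hβ : -1 < β) (hβ0 : β < 0) (T x : ℝ) :
    ∫ t in Ioo 0 T, ∫ s in Ioo 0 T, ∫ y in Ioo 0 T,
      signExp (s - x) * signExp (t - y) * signPow β (t - x) * signPow β (s - y) =
    ∫ y in Ioo 0 T, truncCorr β T x y * truncCorr β T y x := by
  set C := 2 / (β + 1) + 2
  have hC : 0 ≤ C := (abs_nonneg _).trans (abs_truncCorr_le hβ hβ0 T x x)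
  have h1 : ∀ t, ∫ s in Ioo 0 T, ∫ y in Ioo 0 T,
      signExp (s - x) * signExp (t - y) * signPow β (t - x) * signPow β (s - y) =
      ∫ y in Ioo 0 T, truncCorr β T x y * (signExp (t - y) * signPow β (t - x)) := by
    intro t
    rw [MeasureTheory.integral_integral_swap]
    · congr 1; ext y
      rw [truncCorr, ← MeasureTheory.integral_mul_const]
      congr 1; ext s; ring
    · refine Integrable.mono' (g := fun p : ℝ × ℝ =>
        |signPow β (t - x)| * |signExp (p.1 - x) * signPow β (p.1 - p.2)|)
        (Integrable.const_mul ?_ _) (Measurable.aestronglyMeasurable ?_)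
        (Eventually.of_forall fun p => ?_)
      · refine (integrable_prod_of_integral_abs_le (C := C) (by fun_prop)
          (fun y => (integrable_signExp_mul_signPow hβ hβ0 x y).abs.integrableOn) fun y => ?_)
        simp only [abs_abs]
        exact setIntegral_abs_signExp_mul_signPow_le hβ hβ0 T x y
      · simp only [Function.uncurry_def]; fun_prop
      · have e := abs_signExp_le_one (t - p.2)
        simp only [Function.uncurry_def, Real.norm_eq_abs, abs_mul]
        calc _ = |signExp (t - p.2)| * (|signPow β (t - x)| *
              (|signExp (p.1 - x)| * |signPow β (p.1 - p.2)|)) := by ring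
          _ ≤ _ := mul_le_of_le_one_left (by positivity) e
  simp_rw [h1]
  rw [MeasureTheory.integral_integral_swap]
  · simp_rw [MeasureTheory.integral_const_mul]
    rfl
  · refine Integrable.bdd_mul (c := C) (f := fun p : ℝ × ℝ => truncCorr β T x p.2)
      (g := fun p : ℝ × ℝ => signExp (p.1 - p.2) * signPow β (p.1 - x))
      (integrable_prod_of_integral_abs_le (C := C) (by fun_prop)
        (fun y => (integrable_signExp_mul_signPow hβ hβ0 y x).integrableOn)
        fun y => setIntegral_abs_signExp_mul_signPow_le hβ hβ0 T y x)
      (((measurable_truncCorr β T).comp (by fun_prop : Measurable fun p : ℝ × ℝ =>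
        (x, p.2))).aestronglyMeasurable)
      (Eventually.of_forall fun p => abs_truncCorr_le hβ hβ0 T x p.2)

lemma abs_signCorr_sub_truncCorr_le {β : ℝ} (hβ : -1 < β) (hβ0 : β < 0) {T x y : ℝ}
    (hx : x ∈ Ioo 0 T) (hy : y ∈ Ioo 0 T) :
    |signCorr β (x - y) - truncCorr β T x y| ≤
      Real.exp (-x) * y ^ β + Real.exp (-(T - x)) * (T - y) ^ β := by
  have hi := integrable_signExp_mul_signPow hβ hβ0 x y
  have hsplit : signCorr β (x - y) - truncCorr β T x y =
      (∫ s in Iic (0 : ℝ), signExp (s - x) * signPow β (s - y)) +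
        ∫ s in Ioi T, signExp (s - x) * signPow β (s - y) := by
    have h1 := intervalIntegral.integral_Iic_add_Ioi (b := T) hi.integrableOn hi.integrableOn
    have h2 := intervalIntegral.integral_Iic_sub_Iic (a := 0) (b := T) hi.integrableOn
      hi.integrableOn
    rw [← integral_signExp_mul_signPow, truncCorr, ← integral_Ioc_eq_integral_Ioo,
      ← intervalIntegral.integral_of_le (hx.1.trans hx.2).le]
    linarith
  have hA : |∫ s in Iic (0 : ℝ), signExp (s - x) * signPow β (s - y)| ≤ Real.exp (-x) * y ^ β := by
    have hb : ∫ s in Iic (0 : ℝ), Real.exp (-x) * y ^ β * Real.exp s = Real.exp (-x) * y ^ β := by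
      rw [MeasureTheory.integral_const_mul, integral_exp_Iic]; simp
    rw [← hb, ← Real.norm_eq_abs]
    refine MeasureTheory.norm_integral_le_of_norm_le
      ((integrableOn_exp_Iic 0).const_mul _) ?_
    filter_upwards [ae_restrict_mem measurableSet_Iic] with s hs
    have hs : s ≤ 0 := hs
    refine (abs_signExp_mul_signPow_le β x y s).trans ?_
    rw [abs_of_neg (by linarith [hx.1] : s - x < 0), abs_of_neg (by linarith [hy.1] : s - y < 0),
      show -(-(s - x)) = -x + s by ring, Real.exp_add, mul_right_comm]
    gcongr 1
    gcongr 1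
    exact Real.rpow_le_rpow_of_nonpos hy.1 (by linarith) hβ0.le
  have hB : |∫ s in Ioi T, signExp (s - x) * signPow β (s - y)| ≤
      Real.exp (-(T - x)) * (T - y) ^ β := by
    have hb : ∫ s in Ioi T, Real.exp (-(T - x)) * (T - y) ^ β * Real.exp T * Real.exp (-s) =
        Real.exp (-(T - x)) * (T - y) ^ β := by
      rw [MeasureTheory.integral_const_mul, integral_exp_neg_Ioi, mul_assoc, ← Real.exp_add]; simp
    rw [← hb, ← Real.norm_eq_abs]
    refine MeasureTheory.norm_integral_le_of_norm_le
      (g := fun s => Real.exp (-(T - x)) * (T - y) ^ β * Real.exp T * Real.exp (-s))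
      ((integrableOn_exp_neg_Ioi T).const_mul _) ?_
    filter_upwards [ae_restrict_mem measurableSet_Ioi] with s hs
    have hs : T < s := hs
    refine (abs_signExp_mul_signPow_le β x y s).trans ?_
    rw [abs_of_pos (by linarith [hx.2] : 0 < s - x), abs_of_pos (by linarith [hy.2] : 0 < s - y),
      show -(s - x) = -(T - x) + T + -s by ring, Real.exp_add, Real.exp_add]
    have := Real.rpow_le_rpow_of_nonpos (by linarith [hy.2] : 0 < T - y)
      (by linarith : T - y ≤ s - y) hβ0.le
    calc _ ≤ Real.exp (-(T - x)) * Real.exp T * Real.exp (-s) * (T - y) ^ β := by gcongr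
      _ = _ := by ring
  rw [hsplit]
  exact (abs_add_le _ _).trans (add_le_add hA hB)

lemma tendsto_average_integral_sub {f : ℝ → ℝ} (hf : Integrable f) :
    Tendsto (fun T : ℝ => (∫ x in (0 : ℝ)..T, ∫ y in (0 : ℝ)..T, f (x - y)) / T) atTop
      (𝓝 (∫ r, f r)) := by
  have h1 : (fun T : ℝ => ∫ z in (0 : ℝ)..1, ∫ r in (T * z - T)..(T * z), f r) =ᶠ[atTop]
      fun T : ℝ => (∫ x in (0 : ℝ)..T, ∫ y in (0 : ℝ)..T, f (x - y)) / T := by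
    filter_upwards [eventually_gt_atTop 0] with T hT
    simp_rw [intervalIntegral.integral_comp_sub_left, sub_zero]
    rw [intervalIntegral.integral_comp_mul_left (fun x => ∫ r in (x - T)..x, f r) hT.ne']
    simp [div_eq_inv_mul]
  refine Tendsto.congr' h1 ?_
  have h2 : ∫ r, f r = ∫ _z in (0 : ℝ)..1, ∫ r, f r := by simp
  rw [h2]
  refine intervalIntegral.tendsto_integral_filter_of_dominated_convergence
    (fun _ => ∫ r, |f r|) ?_ ?_ intervalIntegrable_const ?_
  · refine Eventually.of_forall fun T => Continuous.aestronglyMeasurable ?_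
    have hc := intervalIntegral.continuous_primitive (fun a b => hf.intervalIntegrable) (0 : ℝ)
    have e : (fun z : ℝ => ∫ r in (T * z - T)..(T * z), f r) =
        fun z : ℝ => (∫ r in (0 : ℝ)..(T * z), f r) - ∫ r in (0 : ℝ)..(T * z - T), f r := by
      ext z
      rw [intervalIntegral.integral_interval_sub_left hf.intervalIntegrable hf.intervalIntegrable]
    rw [e]
    exact (hc.comp (by fun_prop)).sub (hc.comp (by fun_prop))
  · refine Eventually.of_forall fun T => Eventually.of_forall fun z _ => ?_
    exact intervalIntegral.norm_integral_le_integral_norm_uIoc.trans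
      (setIntegral_le_integral hf.norm (Eventually.of_forall fun r => norm_nonneg _))
  · have h0 : ∀ᵐ z : ℝ, z ≠ 1 := by simp [ae_iff, measure_singleton]
    filter_upwards [h0] with z hz1 hz
    rw [uIoc_of_le zero_le_one] at hz
    have hz1 : z < 1 := lt_of_le_of_ne hz.2 hz1
    refine intervalIntegral_tendsto_integral hf ?_ (tendsto_id.atTop_mul_const hz.1)
    have : (fun T : ℝ => T * z - T) = fun T => T * (z - 1) := by ext T; ring
    rw [this]
    exact tendsto_id.atTop_mul_const_of_neg (by linarith)

lemma setIntegral_Ioo_exp_neg_le (T : ℝ) :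
    ∫ x in Ioo 0 T, Real.exp (-x) ≤ 1 := by
  rw [← integral_exp_neg_Ioi_zero]
  exact setIntegral_mono_set (integrableOn_exp_neg_Ioi 0)
    (Eventually.of_forall fun x => (Real.exp_pos _).le) Ioo_subset_Ioi_self.eventuallyLE

lemma setIntegral_Ioo_comp_sub (f : ℝ → ℝ) {T : ℝ} (hT : 0 ≤ T) :
    ∫ x in Ioo 0 T, f (T - x) = ∫ x in Ioo 0 T, f x := by
  rw [← integral_Ioc_eq_integral_Ioo, ← integral_Ioc_eq_integral_Ioo,
    ← intervalIntegral.integral_of_le hT, ← intervalIntegral.integral_of_le hT]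
  simp [intervalIntegral.integral_comp_sub_left f T]

lemma setIntegral_Ioo_rpow {β : ℝ} (hβ : -1 < β) {T : ℝ} (hT : 0 ≤ T) :
    ∫ x in Ioo 0 T, x ^ β = T ^ (β + 1) / (β + 1) := by
  rw [← integral_Ioc_eq_integral_Ioo, ← intervalIntegral.integral_of_le hT,
    integral_rpow (Or.inl hβ), Real.zero_rpow (by linarith), sub_zero]

lemma integrableOn_Ioo_rpow {β : ℝ} (hβ : -1 < β) {T : ℝ} (hT : 0 ≤ T) :
    IntegrableOn (fun x : ℝ => x ^ β) (Ioo 0 T) :=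
  (((intervalIntegrable_iff_integrableOn_Ioc_of_le hT).1
    (intervalIntegrable_rpow' hβ)).mono_set Ioo_subset_Ioc_self)

lemma abs_setIntegral_truncCorr_mul_sub_le {β : ℝ} (hβ : -1 < β) (hβ0 : β < 0) {T : ℝ}
    (hT : 0 ≤ T) :
    |(∫ x in Ioo 0 T, ∫ y in Ioo 0 T, truncCorr β T x y * truncCorr β T y x) -
      ∫ x in Ioo 0 T, ∫ y in Ioo 0 T, signCorr β (x - y) ^ 2| ≤
      (2 / (β + 1) + 2) * (4 * (T ^ (β + 1) / (β + 1))) := by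
  set C := 2 / (β + 1) + 2
  have hu := abs_truncCorr_le hβ hβ0 T
  have hh := abs_signCorr_le hβ hβ0
  have hC : 0 ≤ C := (abs_nonneg _).trans (hh 0)
  have hm := measurable_truncCorr β T
  have hm' : Measurable fun p : ℝ × ℝ => truncCorr β T p.2 p.1 := hm.comp measurable_swap
  set μ : Measure ℝ := volume.restrict (Ioo 0 T)
  have i1 : Integrable (fun p : ℝ × ℝ => truncCorr β T p.1 p.2 * truncCorr β T p.2 p.1)
      (μ.prod μ) := by
    refine (integrable_const (C * C)).mono' (hm.mul hm').aestronglyMeasurable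
      (Eventually.of_forall fun p => ?_)
    rw [Real.norm_eq_abs, abs_mul]
    exact mul_le_mul (hu _ _) (hu _ _) (abs_nonneg _) hC
  have i2 : Integrable (fun p : ℝ × ℝ => signCorr β (p.1 - p.2) ^ 2) (μ.prod μ) := by
    refine (integrable_const (C ^ 2)).mono' (((continuous_signCorr hβ hβ0).comp
      (by fun_prop)).pow 2).aestronglyMeasurable (Eventually.of_forall fun p => ?_)
    rw [Real.norm_eq_abs, abs_pow]
    exact pow_le_pow_left₀ (abs_nonneg _) (hh _) 2
  rw [MeasureTheory.integral_integral i1, MeasureTheory.integral_integral i2,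
    ← MeasureTheory.integral_sub i1 i2]
  have ie : Integrable (fun x : ℝ => Real.exp (-x)) μ :=
    (integrableOn_exp_neg_Ioi 0).mono_set Ioo_subset_Ioi_self
  have ie' : Integrable (fun x : ℝ => Real.exp (-(T - x))) μ :=
    (Continuous.integrableOn_Icc (by fun_prop)).mono_set Ioo_subset_Icc_self
  have ip : Integrable (fun x : ℝ => x ^ β) μ := integrableOn_Ioo_rpow hβ hT
  have ip' : Integrable (fun x : ℝ => (T - x) ^ β) μ := by
    have h := (intervalIntegrable_rpow' hβ (a := 0) (b := T)).comp_sub_left T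
    rw [sub_zero, sub_self] at h
    exact ((intervalIntegrable_iff_integrableOn_Ioc_of_le hT).1 h.symm).mono_set Ioo_subset_Ioc_self
  have b1 : ∫ x, Real.exp (-x) ∂μ ≤ 1 := setIntegral_Ioo_exp_neg_le T
  have b1' : ∫ x, Real.exp (-(T - x)) ∂μ ≤ 1 :=
    (setIntegral_Ioo_comp_sub (fun x => Real.exp (-x)) hT).trans_le b1
  have b2 : ∫ x, x ^ β ∂μ = T ^ (β + 1) / (β + 1) := setIntegral_Ioo_rpow hβ hT
  have b2' : ∫ x, (T - x) ^ β ∂μ = T ^ (β + 1) / (β + 1) :=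
    (setIntegral_Ioo_comp_sub (fun x => x ^ β) hT).trans b2
  have j1 := (ie.mul_prod ip).add (ie'.mul_prod ip')
  have j2 := (ip.mul_prod ie).add (ip'.mul_prod ie')
  have hR : 0 ≤ T ^ (β + 1) / (β + 1) := div_nonneg (Real.rpow_nonneg hT _) (by linarith)
  rw [← Real.norm_eq_abs]
  refine (MeasureTheory.norm_integral_le_of_norm_le ((j1.add j2).const_mul C) ?_).trans ?_
  · rw [Measure.prod_restrict]
    filter_upwards [ae_restrict_mem (measurableSet_Ioo.prod measurableSet_Ioo)] with p hp
    have e1 := abs_signCorr_sub_truncCorr_le hβ hβ0 hp.1 hp.2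
    have e2 := abs_signCorr_sub_truncCorr_le hβ hβ0 hp.2 hp.1
    rw [← neg_sub p.1 p.2, signCorr_neg hβ hβ0] at e2
    set h := signCorr β (p.1 - p.2)
    have k : truncCorr β T p.1 p.2 * truncCorr β T p.2 p.1 - h ^ 2 =
        -((h - truncCorr β T p.1 p.2) * truncCorr β T p.2 p.1 +
          h * (h - truncCorr β T p.2 p.1)) := by ring
    rw [k, norm_neg, Real.norm_eq_abs]
    refine (abs_add_le _ _).trans ?_
    rw [abs_mul, abs_mul]
    have f1 := mul_le_mul e1 (hu p.2 p.1) (abs_nonneg _) ((abs_nonneg _).trans e1)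
    have f2 := mul_le_mul (hh (p.1 - p.2)) e2 (abs_nonneg _) hC
    refine (add_le_add f1 f2).trans_eq ?_
    simp only [Pi.add_apply]
    ring
  · rw [MeasureTheory.integral_const_mul, MeasureTheory.integral_add' j1 j2,
      MeasureTheory.integral_add' (ie.mul_prod ip) (ie'.mul_prod ip'),
      MeasureTheory.integral_add' (ip.mul_prod ie) (ip'.mul_prod ie'),
      integral_prod_mul (fun x => Real.exp (-x)) (fun x => x ^ β),
      integral_prod_mul (fun x => Real.exp (-(T - x))) (fun x => (T - x) ^ β),
      integral_prod_mul (fun x => x ^ β) (fun x => Real.exp (-x)),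
      integral_prod_mul (fun x => (T - x) ^ β) (fun x => Real.exp (-(T - x))), b2, b2']
    refine mul_le_mul_of_nonneg_left ?_ hC
    nlinarith

lemma abs_setIntegral_rpow_le {β : ℝ} (hβ : -1 < β) (hβ0 : β < 0) {T : ℝ} (hT : 0 ≤ T) :
    |∫ x in Ioo 0 T, (∫ t in Ioo 0 T, Real.exp (-t) * signPow β (t - x)) *
      ∫ s in Ioo 0 T, signExp (s - x) * s ^ β| ≤
      (2 / (β + 1) + 2) * (2 * (T ^ (β + 1) / (β + 1))) := by
  set C := 2 / (β + 1) + 2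
  have hC : 0 ≤ C := (abs_nonneg _).trans (abs_truncCorr_le hβ hβ0 T 0 0)
  have h1 : ∀ x, |∫ t in Ioo 0 T, Real.exp (-t) * signPow β (t - x)| ≤ C := by
    intro x
    refine le_trans ?_ (setIntegral_Ioo_exp_neg_abs_mul_abs_rpow_le hβ hβ0 T 0 x)
    rw [← Real.norm_eq_abs]
    refine MeasureTheory.norm_integral_le_of_norm_le
      (integrable_exp_neg_abs_mul_abs_rpow hβ hβ0 0 x).integrableOn ?_
    filter_upwards [ae_restrict_mem measurableSet_Ioo] with t ht
    rw [norm_mul, Real.norm_eq_abs, Real.norm_eq_abs, Real.abs_exp, sub_zero, abs_of_pos ht.1]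
    gcongr
    exact abs_signPow_le _ _
  set μ : Measure ℝ := volume.restrict (Ioo 0 T)
  have hF : Integrable (fun p : ℝ × ℝ => Real.exp (-|p.1 - p.2|) * |p.1 - 0| ^ β) (μ.prod μ) := by
    refine integrable_prod_of_integral_abs_le (C := C) (by fun_prop)
      (fun y => (integrable_exp_neg_abs_mul_abs_rpow hβ hβ0 y 0).integrableOn) fun y => ?_
    refine le_trans (le_of_eq ?_) (setIntegral_Ioo_exp_neg_abs_mul_abs_rpow_le hβ hβ0 T y 0)
    congr 1; ext s
    exact abs_of_nonneg (mul_nonneg (Real.exp_pos _).le (Real.rpow_nonneg (abs_nonneg _) β))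
  have h2 : ∀ x, |∫ s in Ioo 0 T, signExp (s - x) * s ^ β| ≤
      ∫ s in Ioo 0 T, Real.exp (-|s - x|) * |s - 0| ^ β := by
    intro x
    rw [← Real.norm_eq_abs]
    refine MeasureTheory.norm_integral_le_of_norm_le
      (integrable_exp_neg_abs_mul_abs_rpow hβ hβ0 x 0).integrableOn ?_
    filter_upwards [ae_restrict_mem measurableSet_Ioo] with s hs
    rw [norm_mul, Real.norm_eq_abs, sub_zero, abs_of_pos hs.1,
      Real.norm_of_nonneg (Real.rpow_nonneg hs.1.le β)]
    exact mul_le_mul_of_nonneg_right (abs_signExp_le _) (Real.rpow_nonneg hs.1.le β)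
  have hq := hF.integral_prod_right
  rw [← Real.norm_eq_abs]
  refine (MeasureTheory.norm_integral_le_of_norm_le (hq.const_mul C)
    (Eventually.of_forall fun x => ?_)).trans ?_
  · rw [norm_mul]
    exact mul_le_mul (h1 x) (h2 x) (abs_nonneg _) hC
  · rw [MeasureTheory.integral_const_mul]
    refine mul_le_mul_of_nonneg_left ?_ hC
    rw [MeasureTheory.integral_integral_swap
      (f := fun x s => Real.exp (-|s - x|) * |s - 0| ^ β) hF.swap]
    rw [← setIntegral_Ioo_rpow hβ hT, ← MeasureTheory.integral_const_mul]
    refine integral_mono_ae ?_ ((integrableOn_Ioo_rpow hβ hT).const_mul 2) ?_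
    · exact hF.integral_prod_left
    filter_upwards [ae_restrict_mem measurableSet_Ioo] with s hs
    simp only [MeasureTheory.integral_mul_const]
    rw [sub_zero, abs_of_pos hs.1]
    refine mul_le_mul_of_nonneg_right ?_ (Real.rpow_nonneg hs.1.le β)
    have e : ∫ x : ℝ, Real.exp (-|s - x|) = 2 := by
      rw [integral_sub_left_eq_self (fun x => Real.exp (-|x|)) volume s, integral_exp_neg_abs]
    rw [← e]
    exact setIntegral_le_integral (integrable_exp_neg_abs.comp_sub_left s)
      (Eventually.of_forall fun x => (Real.exp_pos _).le)

lemma I1_eq {H T : ℝ} (hH : 0 < H) (hH2 : H < 1 / 2) (hT : 0 ≤ T) :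
    I1 H T = ∫ x in Ioo 0 T, ∫ y in Ioo 0 T,
      truncCorr (2 * H - 1) T x y * truncCorr (2 * H - 1) T y x := by
  simp_rw [← setIntegral_eq_truncCorr_mul (β := 2 * H - 1) (by linarith) (by linarith) T]
  simp only [I1, intervalIntegral.integral_of_le hT, integral_Ioc_eq_integral_Ioo]
  refine MeasureTheory.integral_congr_ae (Eventually.of_forall fun t₁ => ?_)
  refine MeasureTheory.integral_congr_ae (Eventually.of_forall fun t₂ => ?_)
  refine MeasureTheory.integral_congr_ae (Eventually.of_forall fun s₁ => ?_)
  refine MeasureTheory.integral_congr_ae (Eventually.of_forall fun s₂ => ?_)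
  simp only
  rw [sub_eq_add_neg (-|t₁ - s₁|), Real.exp_add, abs_sub_comm t₁ s₁]
  simp only [signExp, signPow]
  ring

lemma I2_eq {H T : ℝ} (hT : 0 ≤ T) :
    I2 H T = 2 * ∫ x in Ioo 0 T, (∫ t in Ioo 0 T, Real.exp (-t) * signPow (2 * H - 1) (t - x)) *
      ∫ s in Ioo 0 T, signExp (s - x) * s ^ (2 * H - 1) := by
  simp only [I2, intervalIntegral.integral_of_le hT, integral_Ioc_eq_integral_Ioo]
  congr 1
  refine MeasureTheory.integral_congr_ae (Eventually.of_forall fun x => ?_)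
  simp only
  rw [← MeasureTheory.integral_mul_const]
  refine MeasureTheory.integral_congr_ae (Eventually.of_forall fun t => ?_)
  simp only
  rw [← MeasureTheory.integral_const_mul]
  refine MeasureTheory.integral_congr_ae (Eventually.of_forall fun s => ?_)
  simp only
  rw [sub_eq_add_neg (-|x - s|), Real.exp_add, abs_sub_comm x s]
  simp only [signExp, signPow]
  ring

lemma abs_I3_le {H T : ℝ} (hH : 0 < H) (hH2 : H < 1 / 2) (hT : 0 ≤ T) :
    |I3 H T| ≤ 4 * (2 / (2 * H - 1 + 1) + 2) ^ 2 := by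
  have hβ : -1 < 2 * H - 1 := by linarith
  have hβ0 : 2 * H - 1 < 0 := by linarith
  set β := 2 * H - 1
  have h1 : ∫ u in (0 : ℝ)..T, Real.exp (-u) * u ^ β =
      ∫ u in (0 : ℝ)..T, Real.exp (-|u - 0|) * |u - 0| ^ β := by
    refine intervalIntegral.integral_congr fun u hu => ?_
    rw [uIcc_of_le hT] at hu
    simp only [sub_zero, abs_of_nonneg hu.1]
  have h2 : Real.exp (-T) * ∫ u in (0 : ℝ)..T, Real.exp u * u ^ β =
      ∫ u in (0 : ℝ)..T, Real.exp (-|u - T|) * |u - 0| ^ β := by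
    rw [← intervalIntegral.integral_const_mul]
    refine intervalIntegral.integral_congr fun u hu => ?_
    rw [uIcc_of_le hT] at hu
    simp only [sub_zero, abs_of_nonneg hu.1, abs_of_nonpos (sub_nonpos.2 hu.2)]
    rw [show -(-(u - T)) = -T + u by ring, Real.exp_add]
    ring
  have hp : ∀ x, 0 ≤ ∫ u in (0 : ℝ)..T, Real.exp (-|u - x|) * |u - 0| ^ β := fun x =>
    intervalIntegral.integral_nonneg hT fun u _ =>
      mul_nonneg (Real.exp_pos _).le (Real.rpow_nonneg (abs_nonneg _) β)
  have hb := fun x => intervalIntegral_exp_neg_abs_mul_abs_rpow_le hβ hβ0 hT x 0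
  rw [I3, h1, h2, abs_of_nonneg (by positivity)]
  have a := pow_le_pow_left₀ (hp 0) (hb 0) 2
  have b := pow_le_pow_left₀ (hp T) (hb T) 2
  linarith

lemma tendsto_div_of_abs_le_rpow {F : ℝ → ℝ} {K a : ℝ} (ha : a < 1)
    (hF : ∀ᶠ T in atTop, |F T| ≤ K * T ^ a) : Tendsto (fun T => F T / T) atTop (𝓝 0) := by
  have h := (tendsto_rpow_neg_atTop (sub_pos.2 ha)).const_mul K
  rw [mul_zero] at h
  refine squeeze_zero_norm' ?_ h
  filter_upwards [hF, eventually_gt_atTop 0] with T hT hT0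
  rw [Real.norm_eq_abs, abs_div, abs_of_pos hT0, neg_sub, Real.rpow_sub_one hT0.ne',
    ← mul_div_assoc]
  gcongr

lemma tendsto_I1_div {H : ℝ} (hH : 0 < H) (hH2 : H < 1 / 2) :
    Tendsto (fun T : ℝ => I1 H T / T) atTop (𝓝 (2 * (Real.Gamma (2 * H) ^ 2 * sigmaH2 H))) := by
  have hβ : -1 < 2 * H - 1 := by linarith
  have hβ0 : 2 * H - 1 < 0 := by linarith
  have hi : Integrable fun r => signCorr (2 * H - 1) r ^ 2 := by
    have h := Integrable.bdd_mul (integrable_signCorr hβ hβ0)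
      (continuous_signCorr hβ hβ0).aestronglyMeasurable
      (Eventually.of_forall fun r => (abs_signCorr_le hβ hβ0 r))
    simpa only [pow_two] using h
  have hl := tendsto_average_integral_sub hi
  rw [integral_signCorr_sq_eq hH hH2] at hl
  have hd := tendsto_div_of_abs_le_rpow (a := 2 * H - 1 + 1)
    (K := (2 / (2 * H - 1 + 1) + 2) * (4 / (2 * H - 1 + 1))) (F := fun T => I1 H T -
      ∫ x in (0 : ℝ)..T, ∫ y in (0 : ℝ)..T, signCorr (2 * H - 1) (x - y) ^ 2) (by linarith) ?_
  · have := hd.add hl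
    rw [zero_add] at this
    refine this.congr fun T => ?_
    ring
  filter_upwards [eventually_ge_atTop 0] with T hT
  rw [I1_eq hH hH2 hT]
  simp only [intervalIntegral.integral_of_le hT, integral_Ioc_eq_integral_Ioo]
  refine (abs_setIntegral_truncCorr_mul_sub_le hβ hβ0 hT).trans_eq ?_
  ring

theorem stmt_4 (H : ℝ) (hH : H ∈ Set.Ioo (0 : ℝ) (1/2)) :
    Filter.Tendsto (fun T : ℝ => fBmNormSqM H T / (2 * T)) Filter.atTop
      (nhds (H ^ 2 * (Real.Gamma (2 * H)) ^ 2 * sigmaH2 H)) := by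
  obtain ⟨h0, h1⟩ := hH
  have hβ : -1 < 2 * H - 1 := by linarith
  have hβ0 : 2 * H - 1 < 0 := by linarith
  have hI2 := tendsto_div_of_abs_le_rpow (F := I2 H) (a := 2 * H - 1 + 1)
    (K := 2 * ((2 / (2 * H - 1 + 1) + 2) * (2 / (2 * H - 1 + 1)))) (by linarith) (by
      filter_upwards [eventually_ge_atTop 0] with T hT
      rw [I2_eq hT, abs_mul, abs_two]
      refine (mul_le_mul_of_nonneg_left (abs_setIntegral_rpow_le hβ hβ0 hT)
        zero_le_two).trans_eq ?_
      ring)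
  have hI3 := tendsto_div_of_abs_le_rpow (F := I3 H) (a := 0)
    (K := 4 * (2 / (2 * H - 1 + 1) + 2) ^ 2) zero_lt_one (by
      filter_upwards [eventually_ge_atTop 0] with T hT
      simpa using abs_I3_le h0 h1 hT)
  have h := ((((tendsto_I1_div h0 h1).add (hI2.const_mul 2)).add hI3).const_mul (H ^ 2 / 2))
  convert h using 2 with T
  · rw [fBmNormSqM, div_mul_eq_div_div]
    ring
  · ring
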